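/- Let m > 0 and e be real constants, let φ : ℝ³ → ℝ be smooth (time-independent), and set h(q, p) = |p|²/(2m) + e·φ(q). Suppose smooth functions Π_i, Πⁱ (i = 1,2,3) on ℝ × (ℝ³ × ℝ³) satisfy the momentum-Vlasov equations ∂Π_i/∂t = −X_h(Π_i) + e·Σ_j (∂²φ/∂q_i∂q_j)·Πʲ and ∂Πⁱ/∂t = −X_h(Πⁱ) − (1/m)·Π_i. Define the energy density 𝓗(t, z) = Σ_i Π_i·X_h(Πⁱ) + (1/(2m))·Σ_i Π_i² + (e/2)·Σ_{i,j} (∂²φ/∂q_i∂q_j)·Πⁱ·Πʲ and the flux function g(t, z) = Σ_i Π_i·( X_h(Πⁱ) + (1/m)·Π_i ). Then the local conservation law ∂𝓗/∂t + X_h(g) = 0 holds pointwise; since the vector field X_h is divergence-free, X_h(g) equals the phase-space divergence of the vector field g·X_h, so this is a conservation law in Eulerian form. -/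

import Mathlib

open MeasureTheory

noncomputable section

/-- Position/momentum 3-space. -/
abbrev V3 : Type := Fin 3 → ℝ

/-- Phase space `ℝ³ × ℝ³` with coordinates `z = (q, p)`. -/
abbrev Phase : Type := V3 × V3

/-- Partial derivative in the `i`-th position variable `q i`. -/
def pq (i : Fin 3) (F : Phase → ℝ) (z : Phase) : ℝ :=
  deriv (fun s => F (Function.update z.1 i s, z.2)) (z.1 i)

/-- Partial derivative in the `i`-th momentum variable `p i`. -/
def pp (i : Fin 3) (F : Phase → ℝ) (z : Phase) : ℝ :=
  deriv (fun s => F (z.1, Function.update z.2 i s)) (z.2 i)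

/-- Partial derivative of a function on `ℝ³`. -/
def dq3 (i : Fin 3) (g : V3 → ℝ) (q : V3) : ℝ :=
  deriv (fun s => g (Function.update q i s)) (q i)

/-- Action of the Hamiltonian vector field of `a` on the function `F`:
`X_a(F) = Σᵢ (∂a/∂pᵢ ∂F/∂qᵢ − ∂a/∂qᵢ ∂F/∂pᵢ)`. -/
def Xact (a F : Phase → ℝ) (z : Phase) : ℝ :=
  ∑ i : Fin 3, (pp i a z * pq i F z - pq i a z * pp i F z)

open scoped ContDiff

section DirectionalDerivatives

variable {E : Type*} [NormedAddCommGroup E] [NormedSpace ℝ E]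

lemma fderiv_fderiv_apply_comm {F : E → ℝ} (hF : ContDiff ℝ ∞ F) (x v w : E) :
    fderiv ℝ (fun y => fderiv ℝ F y v) x w = fderiv ℝ (fun y => fderiv ℝ F y w) x v := by
  have hd : DifferentiableAt ℝ (fderiv ℝ F) x :=
    (hF.fderiv_right (m := ∞) (by simp)).differentiable (by simp) x
  have hs : IsSymmSndFDerivAt ℝ F x :=
    hF.contDiffAt.isSymmSndFDerivAt (by
      rw [minSmoothness_of_isRCLikeNormedField]; exact WithTop.coe_le_coe.2 le_top)
  rw [fderiv_clm_apply hd (differentiableAt_const v),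
    fderiv_clm_apply hd (differentiableAt_const w)]
  simpa using hs.eq w v

lemma ContDiff.fderiv_const_apply {F : E → ℝ} (hF : ContDiff ℝ ∞ F) (v : E) :
    ContDiff ℝ ∞ (fun x => fderiv ℝ F x v) :=
  (hF.fderiv_right (m := ∞) (by simp)).clm_apply contDiff_const

end DirectionalDerivatives

lemma pq_eq_fderiv {F : Phase → ℝ} {z : Phase} (hF : DifferentiableAt ℝ F z) (i : Fin 3) :
    pq i F z = fderiv ℝ F z (Pi.single i 1, 0) := by
  have hc : HasDerivAt (fun s => (Function.update z.1 i s, z.2) : ℝ → Phase)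
      (Pi.single i 1, 0) (z.1 i) :=
    (hasDerivAt_update z.1 i (z.1 i)).prodMk (hasDerivAt_const _ _)
  have hF' : HasFDerivAt F (fderiv ℝ F z) (Function.update z.1 i (z.1 i), z.2) := by
    simpa using hF.hasFDerivAt
  exact (hF'.comp_hasDerivAt (z.1 i) hc).deriv

lemma pp_eq_fderiv {F : Phase → ℝ} {z : Phase} (hF : DifferentiableAt ℝ F z) (i : Fin 3) :
    pp i F z = fderiv ℝ F z (0, Pi.single i 1) := by
  have hc : HasDerivAt (fun s => (z.1, Function.update z.2 i s) : ℝ → Phase)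
      (0, Pi.single i 1) (z.2 i) :=
    (hasDerivAt_const _ _).prodMk (hasDerivAt_update z.2 i (z.2 i))
  have hF' : HasFDerivAt F (fderiv ℝ F z) (z.1, Function.update z.2 i (z.2 i)) := by
    simpa using hF.hasFDerivAt
  exact (hF'.comp_hasDerivAt (z.2 i) hc).deriv

lemma dq3_eq_fderiv {f : V3 → ℝ} {q : V3} (hf : DifferentiableAt ℝ f q) (i : Fin 3) :
    dq3 i f q = fderiv ℝ f q (Pi.single i 1) := by
  have hf' : HasFDerivAt f (fderiv ℝ f q) (Function.update q i (q i)) := by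
    simpa using hf.hasFDerivAt
  exact (hf'.comp_hasDerivAt (q i) (hasDerivAt_update q i (q i))).deriv

lemma dq3_comm {f : V3 → ℝ} (hf : ContDiff ℝ ∞ f) (i j : Fin 3) (q : V3) :
    dq3 i (fun x => dq3 j f x) q = dq3 j (fun x => dq3 i f x) q := by
  have hd (k : Fin 3) : (fun x => dq3 k f x) = fun x => fderiv ℝ f x (Pi.single k 1) :=
    funext fun x => dq3_eq_fderiv (hf.differentiable (by simp) x) k
  have hdiff (k : Fin 3) : DifferentiableAt ℝ (fun x => fderiv ℝ f x (Pi.single k 1)) q :=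
    (hf.fderiv_const_apply _).differentiable (by simp) q
  rw [hd, hd, dq3_eq_fderiv (hdiff j), dq3_eq_fderiv (hdiff i), fderiv_fderiv_apply_comm hf]

/-- The Hamiltonian vector field of `a`. -/
def hamiltonianField (a : Phase → ℝ) (z : Phase) : Phase :=
  (fun i => pp i a z, fun i => -pq i a z)

lemma contDiff_hamiltonianField {a : Phase → ℝ} (ha : ContDiff ℝ ∞ a) :
    ContDiff ℝ ∞ (hamiltonianField a) := by
  have hd := ha.differentiable (by simp)
  refine ContDiff.prodMk (contDiff_pi.2 fun i => ?_) (contDiff_pi.2 fun i => ContDiff.neg ?_)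
  · exact (funext fun z => pp_eq_fderiv (hd z) i : pp i a = _) ▸
      ha.fderiv_const_apply (0, Pi.single i 1)
  · exact (funext fun z => pq_eq_fderiv (hd z) i : pq i a = _) ▸
      ha.fderiv_const_apply (Pi.single i 1, 0)

lemma Xact_eq_fderiv (a : Phase → ℝ) {F : Phase → ℝ} {z : Phase} (hF : DifferentiableAt ℝ F z) :
    Xact a F z = fderiv ℝ F z (hamiltonianField a z) := by
  have hv : hamiltonianField a z = ∑ i : Fin 3,
      (pp i a z • ((Pi.single i 1, 0) : Phase) - pq i a z • ((0, Pi.single i 1) : Phase)) := by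
    ext k <;> fin_cases k <;> simp [hamiltonianField, Fin.sum_univ_three]
  rw [hv, map_sum]
  simp only [Xact, map_sub, map_smul, smul_eq_mul, pq_eq_fderiv hF, pp_eq_fderiv hF]

lemma Xact_add (a : Phase → ℝ) {F G : Phase → ℝ} {z : Phase} (hF : DifferentiableAt ℝ F z)
    (hG : DifferentiableAt ℝ G z) :
    Xact a (fun y => F y + G y) z = Xact a F z + Xact a G z := by
  rw [Xact_eq_fderiv a (hF.fun_add hG), Xact_eq_fderiv a hF, Xact_eq_fderiv a hG,
    fderiv_fun_add hF hG]
  simp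

lemma Xact_sum (a : Phase → ℝ) {ι : Type*} (s : Finset ι) {F : ι → Phase → ℝ} {z : Phase}
    (hF : ∀ i ∈ s, DifferentiableAt ℝ (F i) z) :
    Xact a (fun y => ∑ i ∈ s, F i y) z = ∑ i ∈ s, Xact a (F i) z := by
  rw [Xact_eq_fderiv a (DifferentiableAt.fun_sum hF), fderiv_fun_sum hF,
    sum_apply]
  exact Finset.sum_congr rfl fun i hi => (Xact_eq_fderiv a (hF i hi)).symm

lemma Xact_mul (a : Phase → ℝ) {F G : Phase → ℝ} {z : Phase} (hF : DifferentiableAt ℝ F z)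
    (hG : DifferentiableAt ℝ G z) :
    Xact a (fun y => F y * G y) z = F z * Xact a G z + G z * Xact a F z := by
  rw [Xact_eq_fderiv a (hF.fun_mul hG), Xact_eq_fderiv a hF, Xact_eq_fderiv a hG,
    fderiv_fun_mul hF hG]
  simp

lemma Xact_const_mul (a : Phase → ℝ) (c : ℝ) {F : Phase → ℝ} {z : Phase}
    (hF : DifferentiableAt ℝ F z) : Xact a (fun y => c * F y) z = c * Xact a F z := by
  rw [Xact_eq_fderiv a (hF.const_mul c), Xact_eq_fderiv a hF, fderiv_const_mul hF]
  simp

lemma differentiable_space_slice {F : ℝ → Phase → ℝ}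
    (hF : ContDiff ℝ ∞ (fun x : ℝ × Phase => F x.1 x.2)) (t : ℝ) :
    Differentiable ℝ (F t) :=
  (hF.comp (contDiff_const.prodMk contDiff_id :
    ContDiff ℝ ∞ fun z : Phase => (t, z))).differentiable (by simp)

lemma differentiable_time_slice {F : ℝ → Phase → ℝ}
    (hF : ContDiff ℝ ∞ (fun x : ℝ × Phase => F x.1 x.2)) (z : Phase) :
    Differentiable ℝ (fun s => F s z) :=
  (hF.comp (contDiff_id.prodMk contDiff_const :
    ContDiff ℝ ∞ fun s : ℝ => (s, z))).differentiable (by simp)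

lemma fderiv_space_slice {F : ℝ → Phase → ℝ}
    (hF : ContDiff ℝ ∞ (fun x : ℝ × Phase => F x.1 x.2)) (t : ℝ) (z w : Phase) :
    fderiv ℝ (F t) z w = fderiv ℝ (fun x : ℝ × Phase => F x.1 x.2) (t, z) (0, w) := by
  have hx : HasFDerivAt (fun x : ℝ × Phase => F x.1 x.2) _ (t, z) :=
    (hF.differentiable (by simp) (t, z)).hasFDerivAt
  have hc : HasFDerivAt (F t) _ z := hx.comp z (hasFDerivAt_prodMk_right t z)
  rw [hc.fderiv]
  simp

lemma deriv_time_slice {F : ℝ → Phase → ℝ}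
    (hF : ContDiff ℝ ∞ (fun x : ℝ × Phase => F x.1 x.2)) (t : ℝ) (z : Phase) :
    deriv (fun s => F s z) t = fderiv ℝ (fun x : ℝ × Phase => F x.1 x.2) (t, z) (1, 0) := by
  have hx : HasFDerivAt (fun x : ℝ × Phase => F x.1 x.2) _ (t, z) :=
    (hF.differentiable (by simp) (t, z)).hasFDerivAt
  exact (hx.comp_hasDerivAt t ((hasDerivAt_id t).prodMk (hasDerivAt_const t z))).deriv

lemma Xact_space_slice (a : Phase → ℝ) {F : ℝ → Phase → ℝ}
    (hF : ContDiff ℝ ∞ (fun x : ℝ × Phase => F x.1 x.2)) (t : ℝ) (z : Phase) :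
    Xact a (F t) z =
      fderiv ℝ (fun x : ℝ × Phase => F x.1 x.2) (t, z) (0, hamiltonianField a z) := by
  rw [Xact_eq_fderiv a (differentiable_space_slice hF t z), fderiv_space_slice hF]

lemma contDiff_Xact {a : Phase → ℝ} (ha : ContDiff ℝ ∞ a) {F : ℝ → Phase → ℝ}
    (hF : ContDiff ℝ ∞ (fun x : ℝ × Phase => F x.1 x.2)) :
    ContDiff ℝ ∞ (fun x : ℝ × Phase => Xact a (F x.1) x.2) := by
  simp only [Xact_space_slice a hF]
  exact (hF.fderiv_right (m := ∞) (by simp)).clm_apply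
    (contDiff_const.prodMk ((contDiff_hamiltonianField ha).comp contDiff_snd))

lemma deriv_Xact (a : Phase → ℝ) {F : ℝ → Phase → ℝ}
    (hF : ContDiff ℝ ∞ (fun x : ℝ × Phase => F x.1 x.2)) (t : ℝ) (z : Phase) :
    deriv (fun s => Xact a (F s) z) t = Xact a (fun y => deriv (fun s => F s y) t) z := by
  set v := hamiltonianField a z
  have hv : ContDiff ℝ ∞ (fun x : ℝ × Phase =>
      fderiv ℝ (fun x : ℝ × Phase => F x.1 x.2) (x.1, x.2) (0, v)) := hF.fderiv_const_apply _
  have ht : ContDiff ℝ ∞ (fun x : ℝ × Phase =>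
      fderiv ℝ (fun x : ℝ × Phase => F x.1 x.2) (x.1, x.2) (1, 0)) := hF.fderiv_const_apply _
  simp only [Xact_space_slice a hF, deriv_time_slice hF]
  rw [deriv_time_slice (F := fun s y =>
      fderiv ℝ (fun x : ℝ × Phase => F x.1 x.2) (s, y) (0, v)) hv,
    Xact_space_slice a (F := fun s y =>
      fderiv ℝ (fun x : ℝ × Phase => F x.1 x.2) (s, y) (1, 0)) ht]
  exact fderiv_fderiv_apply_comm hF (t, z) _ _

/-- along solutions of the momentum-Vlasov equations the energy density
`𝓗 = Σᵢ Πᵢ X_h(Πⁱ) + (1/(2m)) Σᵢ Πᵢ² + (e/2) Σᵢⱼ (∂²φ/∂qᵢ∂qⱼ) Πⁱ Πʲ`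
satisfies the local conservation law `∂𝓗/∂t + X_h(g) = 0` with flux function
`g = Σᵢ Πᵢ (X_h(Πⁱ) + (1/m) Πᵢ)`. -/
theorem energy_density_conservation_law
    (m e : ℝ) (hm : 0 < m)
    (φ : V3 → ℝ) (hφ : ContDiff ℝ (⊤ : ℕ∞) φ)
    (h : Phase → ℝ)
    (hh : ∀ z, h z = (∑ i : Fin 3, (z.2 i) ^ 2) / (2 * m) + e * φ z.1)
    (Pq Pp : Fin 3 → ℝ → Phase → ℝ)
    (hPq : ∀ i, ContDiff ℝ (⊤ : ℕ∞) (fun x : ℝ × Phase => Pq i x.1 x.2))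
    (hPp : ∀ i, ContDiff ℝ (⊤ : ℕ∞) (fun x : ℝ × Phase => Pp i x.1 x.2))
    (heq1 : ∀ i t z, deriv (fun s => Pq i s z) t =
      -Xact h (Pq i t) z
        + e * ∑ j : Fin 3, dq3 i (fun q => dq3 j φ q) z.1 * Pp j t z)
    (heq2 : ∀ i t z, deriv (fun s => Pp i s z) t =
      -Xact h (Pp i t) z - (1 / m) * Pq i t z)
    (𝓗 g : ℝ → Phase → ℝ)
    (h𝓗 : ∀ t z, 𝓗 t z =
      (∑ i : Fin 3, Pq i t z * Xact h (Pp i t) z)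
        + (1 / (2 * m)) * ∑ i : Fin 3, (Pq i t z) ^ 2
        + (e / 2) * ∑ i : Fin 3, ∑ j : Fin 3,
            dq3 i (fun q => dq3 j φ q) z.1 * Pp i t z * Pp j t z)
    (hg : ∀ t z, g t z =
      ∑ i : Fin 3, Pq i t z * (Xact h (Pp i t) z + (1 / m) * Pq i t z)) :
    ∀ t z, deriv (fun s => 𝓗 s z) t + Xact h (g t) z = 0 := by
  have hsm : ContDiff ℝ ∞ h := by
    have : h = fun z => (∑ i : Fin 3, (z.2 i) ^ 2) / (2 * m) + e * φ z.1 := funext hh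
    rw [this]
    fun_prop
  have hm0 : m ≠ 0 := hm.ne'
  intro t z
  have hA (i : Fin 3) := differentiable_time_slice (hPq i) z t
  have hB (i : Fin 3) := differentiable_time_slice (hPp i) z t
  have hXB (i : Fin 3) : DifferentiableAt ℝ (fun s => Xact h (Pp i s) z) t :=
    differentiable_time_slice (F := fun s y => Xact h (Pp i s) y) (contDiff_Xact hsm (hPp i)) z t
  have sA (i : Fin 3) : DifferentiableAt ℝ (Pq i t) z := differentiable_space_slice (hPq i) t z
  have sXB (i : Fin 3) : DifferentiableAt ℝ (fun y => Xact h (Pp i t) y) z :=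
    differentiable_space_slice (F := fun s y => Xact h (Pp i s) y) (contDiff_Xact hsm (hPp i)) t z
  have dXB (i : Fin 3) : deriv (fun s => Xact h (Pp i s) z) t =
      -Xact h (fun y => Xact h (Pp i t) y) z - (1 / m) * Xact h (Pq i t) z := by
    have hrhs : (fun y => deriv (fun s => Pp i s y) t) =
        fun y => (-1) * Xact h (Pp i t) y + (-(1 / m)) * Pq i t y := by
      funext y; rw [heq2]; ring
    rw [deriv_Xact h (hPp i), hrhs, Xact_add h ((sXB i).const_mul _) ((sA i).const_mul _),
      Xact_const_mul h _ (sXB i), Xact_const_mul h _ (sA i)]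
    ring
  have hd := ((HasDerivAt.fun_sum fun (i : Fin 3) (_ : i ∈ Finset.univ) =>
      (hA i).hasDerivAt.fun_mul (hXB i).hasDerivAt).fun_add
    ((HasDerivAt.fun_sum fun (i : Fin 3) (_ : i ∈ Finset.univ) =>
      (hA i).hasDerivAt.fun_pow 2).const_mul (1 / (2 * m)))).fun_add
    ((HasDerivAt.fun_sum fun (i : Fin 3) (_ : i ∈ Finset.univ) =>
      HasDerivAt.fun_sum fun (j : Fin 3) (_ : j ∈ Finset.univ) =>
        ((hB i).hasDerivAt.const_mul (dq3 i (fun q => dq3 j φ q) z.1)).fun_mul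
          (hB j).hasDerivAt).const_mul (e / 2))
  have hflux : Xact h (g t) z = ∑ i : Fin 3,
      (Pq i t z * (Xact h (fun y => Xact h (Pp i t) y) z + (1 / m) * Xact h (Pq i t) z) +
        (Xact h (Pp i t) z + (1 / m) * Pq i t z) * Xact h (Pq i t) z) := by
    have sF (i : Fin 3) := (sXB i).fun_add ((sA i).const_mul (1 / m))
    rw [show g t = _ from funext (hg t), Xact_sum h _ fun i _ => (sA i).fun_mul (sF i)]
    refine Finset.sum_congr rfl fun i _ => ?_
    rw [Xact_mul h (sA i) (sF i), Xact_add h (sXB i) ((sA i).const_mul _),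
      Xact_const_mul h _ (sA i)]
  simp only [h𝓗]
  rw [hd.deriv, hflux]
  simp only [heq1, heq2, dXB, Fin.sum_univ_three, dq3_comm hφ 1 0, dq3_comm hφ 2 0,
    dq3_comm hφ 2 1]
  field_simp
  ring
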